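/- Let n ≥ 1 and let w be a permutation of {1,…,2n}. In ℤ[Y₁,…,Y_n] set P₂_w := 2^{n−1} · ( ∏_{i=1}^{n} ρ(w(i)) − ∏_{i=1}^{n} Y_i ) · ∏_{1≤i<j≤n} (ρ(w(i)) + ρ(w(j)))·(ρ(w(i)) + ρ(w(2n+1−j))). Then: if w is signed with an odd number of sign changes, P₂_w = −(−1)^{inv(|w|)} · 2^n · Y₁⋯Y_n · ∏_{1≤i<j≤n} (Y_i + Y_j)(Y_i − Y_j); in all other cases (w signed with an even number of sign changes, or w not signed), P₂_w = 0. -/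

import Mathlib

/-!
Statement 3: restriction property of the polynomial `P₂` representing the equivariant
class of the second closed `SO(2n)`-orbit.  We work 0-indexed: positions `0,…,2n−1`
correspond to `1,…,2n`; the 1-based `2n+1−i` is position `2n−1−i`.
-/

/-- The variable `Y_k` of `ℤ[Y₁,…,Yₙ]` (0-indexed), or `0` if `k` is out of range. -/
noncomputable def Yv (n : ℕ) (k : ℕ) : MvPolynomial (Fin n) ℤ :=
  if h : k < n then MvPolynomial.X ⟨k, h⟩ else 0

/-- `ρ` in the even case (0-indexed): `ρ(k) = Y_k` for `k < n`, `ρ(k) = −Y_{2n−1−k}`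
for `k ≥ n`. -/
noncomputable def rhoEven (n : ℕ) (k : ℕ) : MvPolynomial (Fin n) ℤ :=
  if k < n then Yv n k else - Yv n (2 * n - 1 - k)

/-- `w` is a signed permutation: `w(2n+1−i) = 2n+1−w(i)` for all `i`
(0-indexed: `w(2n−1−k) = 2n−1−w(k)`). -/
def SignedEven (n : ℕ) (w : Equiv.Perm (Fin (2 * n))) : Prop :=
  ∀ k : Fin (2 * n), ((w ⟨2 * n - 1 - (k : ℕ), by omega⟩ : Fin (2 * n)) : ℕ)
    = 2 * n - 1 - ((w k : Fin (2 * n)) : ℕ)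

/-- The number of sign changes of `w`: the number of `i ∈ {1,…,n}` with `w(i) > n`. -/
def signChanges (n : ℕ) (w : Equiv.Perm (Fin (2 * n))) : ℕ :=
  (Finset.univ.filter fun i : Fin n =>
    n ≤ ((w ⟨(i : ℕ), by omega⟩ : Fin (2 * n)) : ℕ)).card

/-- The "absolute value" `|w|(i)`: `w(i)` if `w(i) ≤ n` (1-based), else `2n+1−w(i)`. -/
def absEven (n : ℕ) (w : Equiv.Perm (Fin (2 * n))) (i : Fin n) : ℕ :=
  if ((w ⟨(i : ℕ), by omega⟩ : Fin (2 * n)) : ℕ) < n then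
    ((w ⟨(i : ℕ), by omega⟩ : Fin (2 * n)) : ℕ)
  else 2 * n - 1 - ((w ⟨(i : ℕ), by omega⟩ : Fin (2 * n)) : ℕ)

/-- The number of inversions of `|w|`: pairs `i < j` with `|w|(i) > |w|(j)`. -/
def invEven (n : ℕ) (w : Equiv.Perm (Fin (2 * n))) : ℕ :=
  (Finset.univ.filter fun p : Fin n × Fin n =>
    p.1 < p.2 ∧ absEven n w p.2 < absEven n w p.1).card

/-- `∏_{1≤i<j≤n} (ρ(w(i))+ρ(w(j)))·(ρ(w(i))+ρ(w(2n+1−j)))`. -/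
noncomputable def pairProdEven (n : ℕ) (w : Equiv.Perm (Fin (2 * n))) :
    MvPolynomial (Fin n) ℤ :=
  ∏ p ∈ Finset.univ.filter (fun p : Fin n × Fin n => p.1 < p.2),
    (rhoEven n ((w ⟨(p.1 : ℕ), by omega⟩ : Fin (2 * n)) : ℕ) +
        rhoEven n ((w ⟨(p.2 : ℕ), by omega⟩ : Fin (2 * n)) : ℕ)) *
    (rhoEven n ((w ⟨(p.1 : ℕ), by omega⟩ : Fin (2 * n)) : ℕ) +
        rhoEven n ((w ⟨2 * n - 1 - (p.2 : ℕ), by omega⟩ : Fin (2 * n)) : ℕ))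

/-- `P₂_w = 2^{n−1}·(∏_{i=1}^n ρ(w(i)) − Y₁⋯Yₙ)·∏_{1≤i<j≤n}(ρ(w(i))+ρ(w(j)))(ρ(w(i))+ρ(w(2n+1−j)))`. -/
noncomputable def P2Even (n : ℕ) (w : Equiv.Perm (Fin (2 * n))) :
    MvPolynomial (Fin n) ℤ :=
  2 ^ (n - 1) *
    ((∏ i : Fin n, rhoEven n ((w ⟨(i : ℕ), by omega⟩ : Fin (2 * n)) : ℕ)) -
      ∏ i : Fin n, MvPolynomial.X i) *
    pairProdEven n w

/-- Position `i` of the first half of `{0,…,2n−1}`. -/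
def firstHalf {n : ℕ} (i : Fin n) : Fin (2 * n) :=
  ⟨(i : ℕ), by omega⟩

/-- The map of `{0,…,2n−1}` onto `{0,…,n−1}` that identifies `k` with `2n−1−k`. -/
def foldHalf {n : ℕ} (k : Fin (2 * n)) : Fin n :=
  ⟨if (k : ℕ) < n then (k : ℕ) else 2 * n - 1 - (k : ℕ), by split_ifs <;> omega⟩

theorem mk_two_mul_sub_eq_rev {n : ℕ} (k : Fin (2 * n)) (h : 2 * n - 1 - (k : ℕ) < 2 * n) :
    (⟨2 * n - 1 - (k : ℕ), h⟩ : Fin (2 * n)) = k.rev := by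
  ext
  simp only [Fin.val_rev]
  omega

theorem mk_two_mul_sub_eq_rev_firstHalf {n : ℕ} (i : Fin n) (h : 2 * n - 1 - (i : ℕ) < 2 * n) :
    (⟨2 * n - 1 - (i : ℕ), h⟩ : Fin (2 * n)) = (firstHalf i).rev :=
  mk_two_mul_sub_eq_rev (firstHalf i) h

theorem eq_or_eq_rev_of_foldHalf_eq {n : ℕ} {k l : Fin (2 * n)} (h : foldHalf k = foldHalf l) :
    k = l ∨ k = l.rev := by
  simp only [foldHalf, Fin.mk.injEq] at h
  simp only [Fin.ext_iff, Fin.val_rev]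
  split_ifs at h <;> omega

theorem rhoEven_eq_mul_X {n : ℕ} (k : Fin (2 * n)) :
    rhoEven n k = (if n ≤ (k : ℕ) then -1 else 1) * MvPolynomial.X (foldHalf k) := by
  unfold rhoEven Yv foldHalf
  by_cases h : (k : ℕ) < n
  · simp [h]
  · have h' : 2 * n - 1 - (k : ℕ) < n := by omega
    simp [h, h', not_lt.mp h]

theorem rhoEven_rev {n : ℕ} (k : Fin (2 * n)) : rhoEven n k.rev = -rhoEven n k := by
  have hfold : foldHalf k.rev = foldHalf k := by
    simp only [foldHalf, Fin.mk.injEq, Fin.val_rev]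
    split_ifs <;> omega
  rw [rhoEven_eq_mul_X, rhoEven_eq_mul_X, hfold]
  by_cases h : n ≤ (k : ℕ)
  · have h' : ¬ n ≤ (k.rev : ℕ) := by simp only [Fin.val_rev]; omega
    rw [if_pos h, if_neg h']; ring
  · have h' : n ≤ (k.rev : ℕ) := by simp only [Fin.val_rev]; omega
    rw [if_neg h, if_pos h']; ring

theorem rhoEven_sq {n : ℕ} (k : Fin (2 * n)) :
    rhoEven n k ^ 2 = MvPolynomial.X (foldHalf k) ^ 2 := by
  rw [rhoEven_eq_mul_X]
  split_ifs <;> ring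

theorem signedEven_iff {n : ℕ} (w : Equiv.Perm (Fin (2 * n))) :
    SignedEven n w ↔ ∀ k, w k.rev = (w k).rev := by
  unfold SignedEven
  refine forall_congr' fun k => ?_
  rw [mk_two_mul_sub_eq_rev, Fin.ext_iff, Fin.val_rev]
  omega

theorem Fin.eq_self_of_injective_of_le {n : ℕ} {g : Fin n → Fin n} (hg : Function.Injective g)
    (hle : ∀ i, g i ≤ i) (i : Fin n) : g i = i := by
  induction i using WellFoundedLT.induction with
  | _ i ih =>
    rcases (hle i).lt_or_eq with h | h
    · exact hg (ih _ h)
    · exact h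

/-- If no two of the first `n` values are conjugate and no value at `i` is conjugate to the
value at `2n−1−j` for `i < j`, then `w` is signed. -/
theorem signedEven_of_forall_ne_rev {n : ℕ} (w : Equiv.Perm (Fin (2 * n)))
    (h : ∀ i j : Fin n, i < j → w (firstHalf j) ≠ (w (firstHalf i)).rev ∧
      w (firstHalf j).rev ≠ (w (firstHalf i)).rev) : SignedEven n w := by
  have hex : ∀ i : Fin n, ∃ j : Fin n, j ≤ i ∧ w (firstHalf j).rev = (w (firstHalf i)).rev := by
    intro i
    obtain ⟨m, hm⟩ := w.surjective (w (firstHalf i)).rev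
    by_cases hmn : (m : ℕ) < n
    · exfalso
      have hmf : m = firstHalf ⟨m, hmn⟩ := rfl
      rcases lt_trichotomy i ⟨m, hmn⟩ with hlt | heq | hgt
      · exact (h _ _ hlt).1 hm
      · have hself : w (firstHalf i) = (w (firstHalf i)).rev := by rw [← hm, hmf, ← heq]
        rw [Fin.ext_iff, Fin.val_rev] at hself
        omega
      · refine (h _ _ hgt).1 ?_
        rw [← hmf, hm, Fin.rev_rev]
    · have hmr : (firstHalf ⟨2 * n - 1 - (m : ℕ), by omega⟩ : Fin (2 * n)).rev = m := by
        ext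
        simp only [Fin.val_rev, firstHalf]
        omega
      refine ⟨⟨2 * n - 1 - (m : ℕ), by omega⟩, ?_, by rw [hmr, hm]⟩
      by_contra hlt
      exact (h _ _ (not_le.mp hlt)).2 (by rw [hmr, hm])
  choose g hle hg using hex
  have hinj : Function.Injective g := by
    intro i j hij
    have hw := hg i
    rw [hij, hg j] at hw
    have hf := w.injective (Fin.rev_injective hw)
    simp only [firstHalf, Fin.mk.injEq] at hf
    exact (Fin.ext hf).symm
  have hhalf : ∀ i : Fin n, w (firstHalf i).rev = (w (firstHalf i)).rev := fun i => by
    have hgi := hg i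
    rwa [Fin.eq_self_of_injective_of_le hinj hle i] at hgi
  rw [signedEven_iff]
  intro k
  by_cases hk : (k : ℕ) < n
  · exact hhalf ⟨k, hk⟩
  · have hkr : (k.rev : ℕ) < n := by simp only [Fin.val_rev]; omega
    have hw : w k.rev.rev = (w k.rev).rev := hhalf ⟨k.rev, hkr⟩
    rw [← Fin.rev_inj, ← hw, Fin.rev_rev, Fin.rev_rev]

theorem pairProdEven_eq_zero {n : ℕ} {w : Equiv.Perm (Fin (2 * n))} (hw : ¬ SignedEven n w) :
    pairProdEven n w = 0 := by
  have hex : ∃ i j : Fin n, i < j ∧ (w (firstHalf j) = (w (firstHalf i)).rev ∨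
      w (firstHalf j).rev = (w (firstHalf i)).rev) := by
    by_contra hne
    push Not at hne
    exact hw (signedEven_of_forall_ne_rev w hne)
  obtain ⟨i, j, hij, hor⟩ := hex
  refine Finset.prod_eq_zero (i := (i, j)) (by simpa using hij) ?_
  simp only [mk_two_mul_sub_eq_rev_firstHalf]
  change (rhoEven n (w (firstHalf i)) + rhoEven n (w (firstHalf j))) *
    (rhoEven n (w (firstHalf i)) + rhoEven n (w (firstHalf j).rev)) = 0
  rcases hor with h | h
  · rw [h, rhoEven_rev, add_neg_cancel, zero_mul]
  · rw [h, rhoEven_rev, add_neg_cancel, mul_zero]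

theorem foldHalf_comp_injective {n : ℕ} {w : Equiv.Perm (Fin (2 * n))} (hw : SignedEven n w) :
    Function.Injective fun i : Fin n => foldHalf (w (firstHalf i)) := by
  rw [signedEven_iff] at hw
  intro i j hij
  rcases eq_or_eq_rev_of_foldHalf_eq hij with h | h
  · have hf := w.injective h
    simp only [firstHalf, Fin.mk.injEq] at hf
    exact Fin.ext hf
  · rw [← hw] at h
    have hf := congrArg Fin.val (w.injective h)
    simp only [firstHalf, Fin.val_rev] at hf
    omega

/-- The permutation `|w|` of `{0,…,n−1}` attached to a signed permutation `w`. -/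
noncomputable def absPerm {n : ℕ} {w : Equiv.Perm (Fin (2 * n))} (hw : SignedEven n w) :
    Equiv.Perm (Fin n) :=
  Equiv.ofBijective _ (Finite.injective_iff_bijective.mp (foldHalf_comp_injective hw))

theorem absPerm_apply {n : ℕ} {w : Equiv.Perm (Fin (2 * n))} (hw : SignedEven n w) (i : Fin n) :
    absPerm hw i = foldHalf (w (firstHalf i)) :=
  rfl

theorem prod_rhoEven {n : ℕ} {w : Equiv.Perm (Fin (2 * n))} (hw : SignedEven n w) :
    ∏ i : Fin n, rhoEven n (w (firstHalf i)) =
      (-1) ^ signChanges n w * ∏ i : Fin n, MvPolynomial.X i := by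
  simp only [rhoEven_eq_mul_X, Finset.prod_mul_distrib, ← absPerm_apply hw]
  rw [Equiv.prod_comp (absPerm hw) MvPolynomial.X, ← Finset.prod_filter, Finset.prod_const]
  rfl

theorem prod_filter_lt_eq_prod_Ioi {n : ℕ} {M : Type*} [CommMonoid M] (f : Fin n → Fin n → M) :
    ∏ p ∈ Finset.univ.filter (fun p : Fin n × Fin n => p.1 < p.2), f p.1 p.2 =
      ∏ i, ∏ j ∈ Finset.Ioi i, f i j :=
  Finset.prod_finset_product' _ _ _ (by simp)

theorem Equiv.Perm.sign_eq_neg_one_pow_card_inversions {n : ℕ} (σ : Equiv.Perm (Fin n)) :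
    (σ.sign : ℤ) = (-1) ^ (Finset.univ.filter fun p : Fin n × Fin n =>
      p.1 < p.2 ∧ σ p.2 < σ p.1).card := by
  rw [σ.sign_eq_prod_prod_Ioi, ← prod_filter_lt_eq_prod_Ioi, ← Finset.prod_const,
    ← Finset.filter_filter, Finset.prod_filter (fun p : Fin n × Fin n => σ p.2 < σ p.1),
    Units.coe_prod]
  refine Finset.prod_congr rfl fun p hp => ?_
  have hne : σ p.1 ≠ σ p.2 := σ.injective.ne (by simpa using hp : p.1 < p.2).ne
  rcases hne.lt_or_gt with h | h <;> simp [h, h.not_gt]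

theorem sign_absPerm {n : ℕ} {w : Equiv.Perm (Fin (2 * n))} (hw : SignedEven n w) :
    ((absPerm hw).sign : ℤ) = (-1) ^ invEven n w :=
  (absPerm hw).sign_eq_neg_one_pow_card_inversions

theorem pairProdEven_eq {n : ℕ} {w : Equiv.Perm (Fin (2 * n))} (hw : SignedEven n w) :
    pairProdEven n w = (-1) ^ invEven n w *
      ∏ p ∈ Finset.univ.filter (fun p : Fin n × Fin n => p.1 < p.2),
        (MvPolynomial.X p.1 + MvPolynomial.X p.2) *
          (MvPolynomial.X p.1 - MvPolynomial.X p.2) := by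
  let f : Fin n → Fin n → MvPolynomial (Fin n) ℤ := fun i j =>
    (MvPolynomial.X i + MvPolynomial.X j) * (MvPolynomial.X i - MvPolynomial.X j)
  have hf : ∀ i j, f i j = -f j i := fun i j => by simp only [f]; ring
  have hpair : pairProdEven n w =
      ∏ p ∈ Finset.univ.filter (fun p : Fin n × Fin n => p.1 < p.2),
        f (absPerm hw p.1) (absPerm hw p.2) := by
    refine Finset.prod_congr rfl fun p _ => ?_
    simp only [mk_two_mul_sub_eq_rev_firstHalf, (signedEven_iff w).mp hw, rhoEven_rev]
    have h₁ := rhoEven_sq (w (firstHalf p.1))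
    have h₂ := rhoEven_sq (w (firstHalf p.2))
    rw [← absPerm_apply hw] at h₁ h₂
    change (rhoEven n (w (firstHalf p.1)) + rhoEven n (w (firstHalf p.2))) *
      (rhoEven n (w (firstHalf p.1)) + -rhoEven n (w (firstHalf p.2))) = _
    simp only [f]
    linear_combination h₁ - h₂
  rw [hpair, prod_filter_lt_eq_prod_Ioi fun i j => f (absPerm hw i) (absPerm hw j),
    (absPerm hw).prod_Ioi_comp_eq_sign_mul_prod hf, sign_absPerm hw,
    ← prod_filter_lt_eq_prod_Ioi f]
  simp [f]

theorem P2Even_eq {n : ℕ} {w : Equiv.Perm (Fin (2 * n))} (hw : SignedEven n w) :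
    P2Even n w = 2 ^ (n - 1) * (((-1) ^ signChanges n w - 1) *
      ∏ i : Fin n, MvPolynomial.X i) * pairProdEven n w := by
  rw [sub_one_mul, ← prod_rhoEven hw]
  rfl

theorem stmt3 (n : ℕ) (hn : 1 ≤ n) (w : Equiv.Perm (Fin (2 * n))) :
    (SignedEven n w ∧ Odd (signChanges n w) →
      P2Even n w = -((-1) ^ invEven n w * 2 ^ n *
        (∏ i : Fin n, (MvPolynomial.X i : MvPolynomial (Fin n) ℤ)) *
        ∏ p ∈ Finset.univ.filter (fun p : Fin n × Fin n => p.1 < p.2),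
          (MvPolynomial.X p.1 + MvPolynomial.X p.2) *
            (MvPolynomial.X p.1 - MvPolynomial.X p.2))) ∧
    (¬ (SignedEven n w ∧ Odd (signChanges n w)) → P2Even n w = 0) := by
  constructor
  · rintro ⟨hw, hodd⟩
    obtain ⟨m, rfl⟩ := Nat.exists_eq_add_of_le' hn
    rw [P2Even_eq hw, pairProdEven_eq hw, hodd.neg_one_pow, Nat.add_sub_cancel]
    ring
  · intro h
    by_cases hw : SignedEven n w
    · have heven : Even (signChanges n w) := Nat.not_odd_iff_even.mp fun hodd => h ⟨hw, hodd⟩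
      rw [P2Even_eq hw, heven.neg_one_pow, sub_self, zero_mul, mul_zero, zero_mul]
    · rw [P2Even, pairProdEven_eq_zero hw, mul_zero]
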